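/- arXiv:2111.11178 — 5 statements merged into one kernel-verified Lean document; each statement's English description precedes it below -/
import Mathlib

section
/- Under the single-user Bellman optimality system against the basic sweep jammer, the staying values are strictly decreasing in the state: qs(K+1) < qs(K) for every K ∈ {1,…,T−2}. -/
/-- Under the single-user Bellman optimality system against the basic sweep jammer,
the staying values are strictly decreasing: `qs (K+1) < qs K` for every `K ∈ {1,…,T−2}`. -/
theorem staying_values_strict_decreasing_single_user
    (M m T : ℕ) (hm : 0 < m) (hmM : m < M) (hdvd : m ∣ M)
    (hT : T = M / m) (hT2 : 2 ≤ T)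
    (R C L γ : ℝ) (hR : 0 < R) (hC : 0 < C) (hL : 0 < L)
    (hγ0 : 0 < γ) (hγ1 : γ < 1)
    (qh qs : ℕ → ℝ) (qJ : ℝ)
    (hBh : ∀ K, 1 ≤ K → K ≤ T - 1 →
      qh K = R - C + γ * ((m : ℝ) / M * qJ + ((M : ℝ) - m) / M * max (qs 1) (qh 1)))
    (hBJ : qJ = -L - C + γ * ((m : ℝ) / M * qJ + ((M : ℝ) - m) / M * max (qs 1) (qh 1)))
    (hBs : ∀ K, 1 ≤ K → K ≤ T - 2 →
      qs K = R + γ * ((m : ℝ) / ((M : ℝ) - K * m) * qJ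
        + (1 - (m : ℝ) / ((M : ℝ) - K * m)) * max (qs (K + 1)) (qh (K + 1))))
    (hBsT : qs (T - 1) = R + γ * qJ) :
    ∀ K, 1 ≤ K → K ≤ T - 2 → qs (K + 1) < qs K := by
  have hMT : (M : ℝ) = m * T := by
    exact_mod_cast (hT ▸ (Nat.mul_div_cancel' hdvd).symm : M = m * T)
  have hm0 : (0 : ℝ) < m := by exact_mod_cast hm
  have hratio : ∀ K : ℕ, (m : ℝ) / ((M : ℝ) - K * m) = 1 / ((T : ℝ) - K) := fun K => by
    rw [hMT, show (m : ℝ) * T - K * m = m * (T - K) by ring, div_mul_eq_div_div,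
      div_self hm0.ne']
  have hhop : ∀ K, 1 ≤ K → K ≤ T - 1 → qh K = R + L + qJ := fun K h1 h2 => by
    linarith [hBh K h1 h2]
  have key : ∀ n K : ℕ, 1 ≤ K → K + n + 2 = T → qs (K + 1) < qs K := by
    intro n
    induction n with
    | zero =>
      intro K h1 hK
      have hKT : (T : ℝ) = K + 2 := by exact_mod_cast hK.symm
      have hV := le_max_right (qs (K + 1)) (qh (K + 1))
      rw [hhop (K + 1) (by omega) (by omega)] at hV
      have hs := hBs K h1 (by omega)
      rw [hratio, hKT, hhop (K + 1) (by omega) (by omega),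
        show (K : ℝ) + 2 - K = 2 by ring] at hs
      have hlast : qs (K + 1) = R + γ * qJ := by
        rw [← hBsT]; congr 1; omega
      refine hlast.trans_lt (lt_of_lt_of_eq ?_ hs.symm)
      gcongr
      linarith
    | succ n ih =>
      intro K h1 hK
      have hKT : (T : ℝ) - K = n + 3 := by rw [← hK]; push_cast; ring
      have hKT' : (T : ℝ) - (K + 1 : ℕ) = n + 2 := by rw [← hK]; push_cast; ring
      have hV : max (qs (K + 2)) (R + L + qJ) ≤ max (qs (K + 1)) (R + L + qJ) :=
        max_le_max_right _ (ih (K + 1) (by omega) (by omega)).le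
      have hV' := le_max_right (qs (K + 2)) (R + L + qJ)
      have hs := hBs K h1 (by omega)
      have hs' := hBs (K + 1) (by omega) (by omega)
      rw [hratio, hKT, hhop (K + 1) (by omega) (by omega)] at hs
      rw [hratio, hKT', hhop (K + 1 + 1) (by omega) (by omega)] at hs'
      have hp : 1 / ((n : ℝ) + 3) < 1 / ((n : ℝ) + 2) := by gcongr; norm_num
      have hp1 : 1 / ((n : ℝ) + 3) ≤ 1 := by
        rw [div_le_one (by positivity)]; linarith [n.cast_nonneg (α := ℝ)]
      have hgap := mul_pos (sub_pos.2 hp)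
        (show 0 < max (qs (K + 2)) (R + L + qJ) - qJ by linarith)
      have hmono := mul_le_mul_of_nonneg_left hV (sub_nonneg.2 hp1)
      refine hs'.trans_lt (lt_of_lt_of_eq ?_ hs.symm)
      gcongr R + γ * ?_
      linarith
  exact fun K h1 h2 => key (T - 2 - K) K h1 (by omega)
end

section
/- (Theorem 1: optimality of a K*-staying policy.) Under the single-user Bellman optimality system against the basic sweep jammer, there exists a threshold K* ∈ {0,1,…,T−1} such that for every K ∈ {1,…,T−1}, qs(K) ≥ qh(K) if and only if K ≤ K*. Consequently an optimal frequency hopping policy stays in states K ∈ {1,…,K*} and hops in all other states. -/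
/-- A predicate on `{1,…,N}` that is closed under passing to smaller indices is an initial
segment. -/
theorem exists_threshold_of_antitone {N : ℕ} {P : ℕ → Prop}
    (h : ∀ j k, 1 ≤ j → j ≤ k → k ≤ N → P k → P j) :
    ∃ n, n ≤ N ∧ ∀ k, 1 ≤ k → k ≤ N → (P k ↔ k ≤ n) := by
  classical
  refine ⟨Nat.findGreatest P N, Nat.findGreatest_le N, fun k hk hkN =>
    ⟨fun hP => Nat.le_findGreatest hkN hP, fun hle => ?_⟩⟩
  have hP : P (Nat.findGreatest P N) :=
    Nat.findGreatest_of_ne_zero (m := Nat.findGreatest P N) rfl (by omega)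
  exact h _ _ hk hle (Nat.findGreatest_le N) hP

/-- Putting more weight on the smaller point, and lowering the larger one, lowers a convex
combination. -/
theorem convex_comb_le_convex_comb {a v w p q : ℝ} (hpq : p ≤ q) (hq : q ≤ 1)
    (hav : a ≤ v) (hwv : w ≤ v) : q * a + (1 - q) * w ≤ p * a + (1 - p) * v := by
  nlinarith [mul_nonneg (sub_nonneg.2 hpq) (sub_nonneg.2 hav),
    mul_nonneg (sub_nonneg.2 hq) (sub_nonneg.2 hwv)]

/-- The staying value decreases in the number of consecutive successes when the hopping value is
constant and at least the value in the jammed state. -/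
theorem staying_value_succ_le {T : ℕ} {R γ qJ H : ℝ} {qs : ℕ → ℝ} (hγ : 0 ≤ γ) (hJ : qJ ≤ H)
    (hs : ∀ K, 1 ≤ K → K ≤ T - 2 →
      qs K = R + γ * (1 / ((T : ℝ) - K) * qJ
        + (1 - 1 / ((T : ℝ) - K)) * max (qs (K + 1)) H))
    (hsT : qs (T - 1) = R + γ * qJ) (d : ℕ) :
    ∀ K, 1 ≤ K → K + d + 2 = T → qs (K + 1) ≤ qs K := by
  have hJV (K : ℕ) : qJ ≤ max (qs K) H := hJ.trans (le_max_right _ _)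
  induction d with
  | zero =>
    intro K hK hKT
    obtain rfl : T = K + 2 := by omega
    rw [show qs (K + 1) = R + γ * qJ from hsT, hs K hK (by omega)]
    gcongr R + γ * ?_
    have hp : 1 / (((K + 2 : ℕ) : ℝ) - K) ≤ 1 := by push_cast; norm_num
    simpa using convex_comb_le_convex_comb hp le_rfl (hJV (K + 1)) (hJV (K + 1))
  | succ d ih =>
    intro K hK hKT
    have hmono := ih (K + 1) (by omega) (by omega)
    rw [hs (K + 1) (by omega) (by omega), hs K hK (by omega)]
    have hT : (T : ℝ) = K + d + 3 := by rw [← hKT]; push_cast; ring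
    have hd : (0 : ℝ) ≤ d := d.cast_nonneg
    gcongr R + γ * ?_
    apply convex_comb_le_convex_comb _ _ (hJV (K + 1)) (max_le_max_right H hmono)
    · apply one_div_le_one_div_of_le <;> push_cast <;> linarith
    · rw [div_le_one₀] <;> push_cast <;> linarith


/-- Theorem 1: under the single-user Bellman optimality system against the basic sweep
jammer, there is a threshold `K* ∈ {0,…,T−1}` such that for every `K ∈ {1,…,T−1}`,
staying is greedy-optimal (`qs K ≥ qh K`) if and only if `K ≤ K*`. -/
theorem exists_optimal_staying_threshold_single_user
    (M m T : ℕ) (hm : 0 < m) (hmM : m < M) (hdvd : m ∣ M)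
    (hT : T = M / m) (hT2 : 2 ≤ T)
    (R C L γ : ℝ) (hR : 0 < R) (hC : 0 < C) (hL : 0 < L)
    (hγ0 : 0 < γ) (hγ1 : γ < 1)
    (qh qs : ℕ → ℝ) (qJ : ℝ)
    (hBh : ∀ K, 1 ≤ K → K ≤ T - 1 →
      qh K = R - C + γ * ((m : ℝ) / M * qJ + ((M : ℝ) - m) / M * max (qs 1) (qh 1)))
    (hBJ : qJ = -L - C + γ * ((m : ℝ) / M * qJ + ((M : ℝ) - m) / M * max (qs 1) (qh 1)))
    (hBs : ∀ K, 1 ≤ K → K ≤ T - 2 →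
      qs K = R + γ * ((m : ℝ) / ((M : ℝ) - K * m) * qJ
        + (1 - (m : ℝ) / ((M : ℝ) - K * m)) * max (qs (K + 1)) (qh (K + 1))))
    (hBsT : qs (T - 1) = R + γ * qJ) :
    ∃ Kstar, Kstar ≤ T - 1 ∧ ∀ K, 1 ≤ K → K ≤ T - 1 → (qh K ≤ qs K ↔ K ≤ Kstar) := by
  obtain ⟨t, rfl⟩ := hdvd
  obtain rfl : T = t := by rw [hT, Nat.mul_div_cancel_left _ hm]
  have hm' : (m : ℝ) ≠ 0 := by positivity
  set H : ℝ := R - C + γ * ((m : ℝ) / (m * T : ℕ) * qJ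
    + (((m * T : ℕ) : ℝ) - m) / (m * T : ℕ) * max (qs 1) (qh 1)) with hH
  have hJ : qJ ≤ H := by linarith
  have hp (K : ℕ) : (m : ℝ) / (((m * T : ℕ) : ℝ) - K * m) = 1 / ((T : ℝ) - K) := by
    rw [Nat.cast_mul, mul_comm (K : ℝ), ← mul_sub, div_mul_eq_div_div, div_self hm']
  have hs : ∀ K, 1 ≤ K → K ≤ T - 2 →
      qs K = R + γ * (1 / ((T : ℝ) - K) * qJ
        + (1 - 1 / ((T : ℝ) - K)) * max (qs (K + 1)) H) := by
    intro K hK hKT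
    rw [hBs K hK hKT, hp, hBh (K + 1) (by omega) (by omega)]
  have hanti : ∀ j k, 1 ≤ j → j ≤ k → k ≤ T - 1 → qs k ≤ qs j := by
    intro j k hj hjk
    induction k, hjk using Nat.le_induction with
    | base => exact fun _ => le_rfl
    | succ k hjk ih =>
      intro hk
      exact (staying_value_succ_le hγ0.le hJ hs hBsT (T - 2 - k) k (by omega) (by omega)).trans
        (ih (by omega))
  refine exists_threshold_of_antitone fun j k hj hjk hk hle => ?_
  rw [hBh k (by omega) hk] at hle
  rw [hBh j hj (by omega)]
  exact hle.trans (hanti j k hj hjk hk)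
end

section
/- Under the multi-user Bellman optimality system with inactive probability θ against the basic sweep jammer, the staying values are strictly decreasing in the state: qs(K+1) < qs(K) for every K ∈ {1,…,T−2}. -/
/-- Under the multi-user Bellman optimality system with inactive probability `θ` against
the basic sweep jammer, the staying values are strictly decreasing:
`qs (K+1) < qs K` for every `K ∈ {1,…,T−2}`. -/
theorem staying_values_strict_decreasing_multi_user
    (M m T : ℕ) (hm : 0 < m) (hmM : m < M) (hdvd : m ∣ M)
    (hT : T = M / m) (hT2 : 2 ≤ T)
    (R C L γ θ : ℝ) (hR : 0 < R) (hC : 0 < C) (hL : 0 < L)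
    (hγ0 : 0 < γ) (hγ1 : γ < 1) (hθ0 : 0 ≤ θ) (hθ1 : θ ≤ 1)
    (qh qs : ℕ → ℝ) (qJ qI : ℝ)
    (hBh : ∀ K, 1 ≤ K → K ≤ T - 1 →
      qh K = R - C + γ * (θ * qI + (1 - θ) * ((m : ℝ) / M) * qJ
        + (1 - θ) * (((M : ℝ) - m) / M) * max (qs 1) (qh 1)))
    (hBJ : qJ = -L - C + γ * (θ * qI + (1 - θ) * ((m : ℝ) / M) * qJ
        + (1 - θ) * (((M : ℝ) - m) / M) * max (qs 1) (qh 1)))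
    (hBI : qI = -C + γ * (θ * qI + (1 - θ) * ((m : ℝ) / M) * qJ
        + (1 - θ) * (((M : ℝ) - m) / M) * max (qs 1) (qh 1)))
    (hBs : ∀ K, 1 ≤ K → K ≤ T - 2 →
      qs K = R + γ * ((m : ℝ) / ((M : ℝ) - K * m) * qJ
        + (1 - (m : ℝ) / ((M : ℝ) - K * m)) * max (qs (K + 1)) (qh (K + 1))))
    (hBsT : qs (T - 1) = R + γ * qJ) :
    ∀ K, 1 ≤ K → K ≤ T - 2 → qs (K + 1) < qs K := by
  have hM : (M : ℝ) = T * m := by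
    rw [hT]
    exact_mod_cast (Nat.div_mul_cancel hdvd).symm
  have hm' : (0 : ℝ) < m := by exact_mod_cast hm
  have hratio : ∀ K : ℕ, (m : ℝ) / ((M : ℝ) - K * m) = 1 / ((T : ℝ) - K) := by
    intro K
    rw [hM, ← sub_mul, div_mul_cancel_right₀ hm'.ne', one_div]
  have hVJ : ∀ K, 1 ≤ K → K ≤ T - 1 → qJ < max (qs K) (qh K) := by
    intro K h₁ h₂
    have := hBh K h₁ h₂
    exact lt_max_of_lt_right (by linarith)
  have key : ∀ j K, K + j + 2 = T → 1 ≤ K → qs (K + 1) < qs K := by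
    intro j
    induction j with
    | zero =>
      intro K hK h₁
      have hT' : (T : ℝ) - K = 2 := by
        rw [← hK]
        push_cast
        ring
      have hlast : T - 1 = K + 1 := by omega
      have hV := hVJ (K + 1) (by omega) (by omega)
      rw [hlast] at hBsT
      rw [hBsT, hBs K h₁ (by omega), hratio, hT']
      nlinarith [mul_pos hγ0 (sub_pos.2 hV)]
    | succ j ih =>
      intro K hK h₁
      have hT' : (T : ℝ) - K = j + 3 := by
        rw [← hK]
        push_cast
        ring
      have hT'' : (T : ℝ) - (K + 1 : ℕ) = j + 2 := by
        push_cast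
        linarith
      have hV := hVJ (K + 1 + 1) (by omega) (by omega)
      have hmono : max (qs (K + 1 + 1)) (qh (K + 1 + 1)) ≤ max (qs (K + 1)) (qh (K + 1)) := by
        rw [hBh (K + 1 + 1) (by omega) (by omega), hBh (K + 1) (by omega) (by omega)]
        exact max_le_max_right _ (ih (K + 1) (by omega) (by omega)).le
      have hp : 1 / ((j : ℝ) + 3) < 1 / ((j : ℝ) + 2) :=
        one_div_lt_one_div_of_lt (by positivity) (by linarith)
      have hp1 : 1 / ((j : ℝ) + 3) ≤ 1 := by
        rw [div_le_one (by positivity)]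
        linarith [(Nat.cast_nonneg j : (0 : ℝ) ≤ j)]
      have hsK := hBs K h₁ (by omega)
      have hsK' := hBs (K + 1) (by omega) (by omega)
      rw [hratio, hT'] at hsK
      rw [hratio, hT''] at hsK'
      refine hsK'.trans_lt (lt_of_lt_of_eq ?_ hsK.symm)
      gcongr ?_ + γ * ?_
      nlinarith [mul_nonneg (sub_nonneg.2 hp1) (sub_nonneg.2 hmono),
        mul_pos (sub_pos.2 hp) (sub_pos.2 hV)]
  intro K h₁ h₂
  exact key (T - 2 - K) K (by omega) h₁
end

section
/- (Theorem 3: optimality of a K(θ)-staying policy in the multi-user environment.) Under the multi-user Bellman optimality system with inactive probability θ against the basic sweep jammer, there exists a threshold K(θ) ∈ {0,1,…,T−1} such that for every K ∈ {1,…,T−1}, qs(K) ≥ qh(K) if and only if K ≤ K(θ). Consequently an optimal frequency hopping policy under inactive probability θ stays in states K ∈ {1,…,K(θ)} and hops in all other states. -/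
/-- A stage value that mixes a bad outcome `J` with the better of continuing and a fallback
`h ≥ J` decreases in time when the probability of the bad outcome increases. -/
theorem succ_le_of_bellman_stay {N : ℕ} {R γ J h : ℝ} {s p : ℕ → ℝ} (hγ : 0 ≤ γ) (hJ : J ≤ h)
    (hp1 : ∀ K, K < N → p K ≤ 1) (hp : ∀ K, K + 1 < N → p K ≤ p (K + 1))
    (hs : ∀ K, 1 ≤ K → K < N → s K = R + γ * (p K * J + (1 - p K) * max (s (K + 1)) h))
    (hsN : s N = R + γ * J) :
    ∀ K, 1 ≤ K → K < N → s (K + 1) ≤ s K := by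
  suffices H : ∀ d K, 1 ≤ K → K + 1 + d = N → s (K + 1) ≤ s K from
    fun K hK hKN => H (N - (K + 1)) K hK (by omega)
  intro d
  induction d with
  | zero =>
    intro K hK hKN
    obtain rfl : K + 1 = N := by omega
    rw [hsN, hs K hK (by omega)]
    have h1 := hp1 K (by omega)
    have h2 : J ≤ max (s (K + 1)) h := hJ.trans (le_max_right _ _)
    gcongr R + γ * ?_
    nlinarith
  | succ d ih =>
    intro K hK hKN
    have hmono : max (s (K + 1 + 1)) h ≤ max (s (K + 1)) h :=
      max_le_max_right h (ih (K + 1) (by omega) (by omega))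
    rw [hs (K + 1) (by omega) (by omega), hs K hK (by omega)]
    have h1 := hp1 (K + 1) (by omega)
    have h2 := hp K (by omega)
    have h3 : J ≤ max (s (K + 1)) h := hJ.trans (le_max_right _ _)
    gcongr R + γ * ?_
    nlinarith [mul_le_mul_of_nonneg_left hmono (sub_nonneg.2 h1),
      mul_le_mul_of_nonneg_left h3 (sub_nonneg.2 h2)]

/-- A predicate on `{1, …, N}` that is inherited by predecessors holds exactly up to a threshold. -/
theorem exists_threshold_of_pred {N : ℕ} {P : ℕ → Prop}
    (hP : ∀ K, 1 ≤ K → K < N → P (K + 1) → P K) :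
    ∃ k, k ≤ N ∧ ∀ K, 1 ≤ K → K ≤ N → (P K ↔ K ≤ k) := by
  induction N with
  | zero => exact ⟨0, le_rfl, fun K h1 h0 => by omega⟩
  | succ N ih =>
    by_cases hN : P (N + 1)
    · refine ⟨N + 1, le_rfl, fun K hK hKN => ⟨fun _ => hKN, fun _ => ?_⟩⟩
      exact Nat.decreasingInduction' (P := P)
        (fun j hj hKj hPj => hP j (hK.trans hKj) hj hPj) hKN hN
    · obtain ⟨k, hk, hiff⟩ := ih fun K hK hKN => hP K hK (by omega)
      refine ⟨k, by omega, fun K hK hKN => ?_⟩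
      rcases hKN.eq_or_lt with rfl | hlt
      · exact ⟨fun h => absurd h hN, fun h => by omega⟩
      · exact hiff K hK (by omega)


/-- Theorem 3: under the multi-user Bellman optimality system with inactive probability
`θ` against the basic sweep jammer, there is a threshold `K(θ) ∈ {0,…,T−1}` such that for
every `K ∈ {1,…,T−1}`, staying is greedy-optimal (`qs K ≥ qh K`) iff `K ≤ K(θ)`. -/
theorem exists_optimal_staying_threshold_multi_user
    (M m T : ℕ) (hm : 0 < m) (hmM : m < M) (hdvd : m ∣ M)
    (hT : T = M / m) (hT2 : 2 ≤ T)
    (R C L γ θ : ℝ) (hR : 0 < R) (hC : 0 < C) (hL : 0 < L)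
    (hγ0 : 0 < γ) (hγ1 : γ < 1) (hθ0 : 0 ≤ θ) (hθ1 : θ ≤ 1)
    (qh qs : ℕ → ℝ) (qJ qI : ℝ)
    (hBh : ∀ K, 1 ≤ K → K ≤ T - 1 →
      qh K = R - C + γ * (θ * qI + (1 - θ) * ((m : ℝ) / M) * qJ
        + (1 - θ) * (((M : ℝ) - m) / M) * max (qs 1) (qh 1)))
    (hBJ : qJ = -L - C + γ * (θ * qI + (1 - θ) * ((m : ℝ) / M) * qJ
        + (1 - θ) * (((M : ℝ) - m) / M) * max (qs 1) (qh 1)))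
    (hBI : qI = -C + γ * (θ * qI + (1 - θ) * ((m : ℝ) / M) * qJ
        + (1 - θ) * (((M : ℝ) - m) / M) * max (qs 1) (qh 1)))
    (hBs : ∀ K, 1 ≤ K → K ≤ T - 2 →
      qs K = R + γ * ((m : ℝ) / ((M : ℝ) - K * m) * qJ
        + (1 - (m : ℝ) / ((M : ℝ) - K * m)) * max (qs (K + 1)) (qh (K + 1))))
    (hBsT : qs (T - 1) = R + γ * qJ) :
    ∃ Kθ, Kθ ≤ T - 1 ∧ ∀ K, 1 ≤ K → K ≤ T - 1 → (qh K ≤ qs K ↔ K ≤ Kθ) := by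
  have hm' : (0 : ℝ) < m := by exact_mod_cast hm
  have hMT : (M : ℝ) = T * m := by
    rw [hT]
    exact_mod_cast (Nat.div_mul_cancel hdvd).symm
  have hh : ∀ K, 1 ≤ K → K ≤ T - 1 → qh K = qJ + L + R := fun K hK hKT => by
    linarith [hBh K hK hKT]
  have hgap : ∀ K, K < T - 1 → (m : ℝ) ≤ M - (K + 1) * m := fun K hK => by
    have hKT : (K : ℝ) + 2 ≤ T := by exact_mod_cast (by omega : K + 2 ≤ T)
    nlinarith
  have hanti := succ_le_of_bellman_stay (N := T - 1) (R := R) (h := qJ + L + R) (s := qs)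
    (p := fun K => (m : ℝ) / (M - K * m)) hγ0.le (by linarith)
    (fun K hK => div_le_one_of_le₀ (by linarith [hgap K hK]) (by linarith [hgap K hK]))
    (fun K hK => by
      have hlast := hgap K (by omega)
      push_cast
      exact div_le_div_of_nonneg_left hm'.le (by linarith) (by linarith))
    (fun K hK hKT => by
      rw [hBs K hK (by omega), hh (K + 1) (by omega) (by omega)])
    hBsT
  refine exists_threshold_of_pred fun K hK hKT hstay => ?_
  rw [hh (K + 1) (by omega) (by omega)] at hstay
  rw [hh K hK hKT.le]
  exact hstay.trans (hanti K hK hKT)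
end

section
/- (Theorem 4, abstract form.) Let T ≥ 1 and let h : ℝ → ℝ be monotone (order-preserving) on the interval [0,1], with h([0,1]) ⊆ [0,1] and such that the image h([0,1]) has at most T elements. Then for every θ ∈ [0,1] there exists s with 1 ≤ s ≤ T such that h(h^[s](θ)) = h^[s](θ); that is, iterating h from any starting point in [0,1] reaches a fixed point of h within at most T iterations. -/
theorem MonotoneOn.monotone_iterate_apply {α : Type*} [Preorder α] {f : α → α} {s : Set α}
    {x : α} (hf : MonotoneOn f s) (hs : Set.MapsTo f s s) (hx : x ∈ s) (h : x ≤ f x) :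
    Monotone fun n => f^[n] x := by
  refine monotone_nat_of_le_succ fun n => ?_
  induction n with
  | zero => exact h
  | succ n ih =>
    simp only [Function.iterate_succ_apply'] at ih ⊢
    exact hf (hs.iterate n hx) (hs (hs.iterate n hx)) ih

theorem MonotoneOn.antitone_iterate_apply {α : Type*} [Preorder α] {f : α → α} {s : Set α}
    {x : α} (hf : MonotoneOn f s) (hs : Set.MapsTo f s s) (hx : x ∈ s) (h : f x ≤ x) :
    Antitone fun n => f^[n] x :=
  MonotoneOn.monotone_iterate_apply (α := αᵒᵈ) hf.dual hs hx h

theorem Monotone.apply_succ_eq_of_apply_eq {α : Type*} [PartialOrder α] {u : ℕ → α}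
    (hu : Monotone u) {i j : ℕ} (hij : i < j) (h : u i = u j) : u (i + 1) = u i :=
  le_antisymm (h ▸ hu hij) (hu i.le_succ)

theorem MonotoneOn.apply_iterate_eq_of_iterate_eq {α : Type*} [LinearOrder α] {f : α → α}
    {s : Set α} {x : α} (hf : MonotoneOn f s) (hs : Set.MapsTo f s s) (hx : x ∈ s) {i j : ℕ}
    (hij : i < j) (h : f^[i] x = f^[j] x) : f (f^[i] x) = f^[i] x := by
  rw [← Function.iterate_succ_apply' f i x]
  rcases le_total x (f x) with hle | hle
  · exact (hf.monotone_iterate_apply hs hx hle).apply_succ_eq_of_apply_eq hij h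
  · exact (hf.antitone_iterate_apply hs hx hle).dual_right.apply_succ_eq_of_apply_eq hij h

/-- Theorem 4, abstract form: if `h` is monotone on `[0,1]`, maps `[0,1]` into itself, and
its image `h '' [0,1]` has at most `T ≥ 1` elements, then iterating `h` from any starting
point in `[0,1]` reaches a fixed point of `h` within at most `T` iterations. -/
theorem iterates_reach_fixed_point (T : ℕ) (hT : 1 ≤ T) (h : ℝ → ℝ)
    (hmono : MonotoneOn h (Set.Icc 0 1))
    (hmaps : Set.MapsTo h (Set.Icc 0 1) (Set.Icc 0 1))
    (hcard : ∃ s : Finset ℝ, h '' Set.Icc 0 1 ⊆ ↑s ∧ s.card ≤ T) :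
    ∀ θ ∈ Set.Icc (0 : ℝ) 1, ∃ s, 1 ≤ s ∧ s ≤ T ∧ h (h^[s] θ) = h^[s] θ := by
  intro θ hθ
  obtain ⟨S, hS, hST⟩ := hcard
  have hmem : ∀ n ∈ Finset.Icc 1 (T + 1), h^[n] θ ∈ S := by
    intro n hn
    obtain ⟨m, rfl⟩ := Nat.exists_eq_add_of_le' (Finset.mem_Icc.mp hn).1
    rw [Function.iterate_succ_apply']
    exact hS ⟨_, hmaps.iterate m hθ, rfl⟩
  obtain ⟨i, hi, j, hj, hne, heq⟩ :=
    Finset.exists_ne_map_eq_of_card_lt_of_maps_to (by simpa using Nat.lt_succ_of_le hST) hmem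
  rw [Finset.mem_Icc] at hi hj
  rcases hne.lt_or_gt with hij | hij
  · exact ⟨i, hi.1, by omega, hmono.apply_iterate_eq_of_iterate_eq hmaps hθ hij heq⟩
  · exact ⟨j, hj.1, by omega, hmono.apply_iterate_eq_of_iterate_eq hmaps hθ hij heq.symm⟩
end
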